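/- arXiv:1609.07825 — 2 statements merged into one kernel-verified Lean document; each statement's English description precedes it below -/
import Mathlib

section
/- Let u, v : ℝ × ℝ → ℝ be smooth functions of (x,t) solving the generalized Riemann equation at N=2, i.e. u_t = 2u·u_x − 2v and v_t = 2u·v_x, and assume v_x is nowhere zero. Define α₁ = u_x²·v_x^{−2} − 2·v_x^{−1}, β₁ = u_x·v_x^{−1}, and recursively α_{k+1} = v_x^{−1}·∂_x α_k, β_{k+1} = v_x^{−1}·∂_x β_k for k ≥ 1. Then at every point: ∂_t α_k = 2u·∂_x α_k for all k ≥ 1, ∂_t β₁ = 2u·∂_x β₁ − 2, and ∂_t β_k = 2u·∂_x β_k for all k ≥ 2. -/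
/-- Partial derivative with respect to the first variable `x`. -/
noncomputable def pdx (f : ℝ × ℝ → ℝ) (p : ℝ × ℝ) : ℝ := deriv (fun x => f (x, p.2)) p.1

/-- Partial derivative with respect to the second variable `t`. -/
noncomputable def pdt (f : ℝ × ℝ → ℝ) (p : ℝ × ℝ) : ℝ := deriv (fun t => f (p.1, t)) p.2

theorem pdx_eq_fderiv {f : ℝ × ℝ → ℝ} (hf : Differentiable ℝ f) (p : ℝ × ℝ) :
    pdx f p = fderiv ℝ f p (1, 0) := by
  have h : HasDerivAt (fun x : ℝ => (x, p.2)) ((1 : ℝ), (0 : ℝ)) p.1 :=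
    (hasDerivAt_id p.1).prodMk (hasDerivAt_const p.1 p.2)
  exact ((hf p).hasFDerivAt.comp_hasDerivAt p.1 h).deriv

theorem pdt_eq_fderiv {f : ℝ × ℝ → ℝ} (hf : Differentiable ℝ f) (p : ℝ × ℝ) :
    pdt f p = fderiv ℝ f p (0, 1) := by
  have h : HasDerivAt (fun t : ℝ => (p.1, t)) ((0 : ℝ), (1 : ℝ)) p.2 :=
    (hasDerivAt_const p.2 p.1).prodMk (hasDerivAt_id p.2)
  exact ((hf p).hasFDerivAt.comp_hasDerivAt p.2 h).deriv

theorem hasDerivAt_pdx {f : ℝ × ℝ → ℝ} (hf : Differentiable ℝ f) (p : ℝ × ℝ) :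
    HasDerivAt (fun x => f (x, p.2)) (pdx f p) p.1 :=
  DifferentiableAt.hasDerivAt (f := fun x => f (x, p.2)) (by fun_prop)

theorem hasDerivAt_pdt {f : ℝ × ℝ → ℝ} (hf : Differentiable ℝ f) (p : ℝ × ℝ) :
    HasDerivAt (fun t => f (p.1, t)) (pdt f p) p.2 :=
  DifferentiableAt.hasDerivAt (f := fun t => f (p.1, t)) (by fun_prop)

theorem ContDiff.differentiable_of_smooth {f : ℝ × ℝ → ℝ} (hf : ContDiff ℝ (⊤ : ℕ∞) f) :
    Differentiable ℝ f :=
  hf.differentiable (by simp)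

theorem contDiff_pdx {f : ℝ × ℝ → ℝ} (hf : ContDiff ℝ (⊤ : ℕ∞) f) :
    ContDiff ℝ (⊤ : ℕ∞) (pdx f) := by
  rw [funext (pdx_eq_fderiv hf.differentiable_of_smooth)]
  exact (hf.fderiv_right (by simp)).clm_apply contDiff_const

theorem pdt_pdx_comm {f : ℝ × ℝ → ℝ} (hf : ContDiff ℝ (⊤ : ℕ∞) f) (p : ℝ × ℝ) :
    pdt (pdx f) p = pdx (pdt f) p := by
  have hd := hf.differentiable_of_smooth
  have hf' : Differentiable ℝ (fderiv ℝ f) :=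
    (hf.fderiv_right (m := (⊤ : ℕ∞)) (by simp)).differentiable (by simp)
  have happ (w : ℝ × ℝ) : Differentiable ℝ fun q => fderiv ℝ f q w := by fun_prop
  have hsymm : IsSymmSndFDerivAt ℝ f p :=
    hf.contDiffAt.isSymmSndFDerivAt (by
      rw [minSmoothness_of_isRCLikeNormedField]
      exact WithTop.coe_le_coe.mpr le_top)
  rw [funext (pdx_eq_fderiv hd), funext (pdt_eq_fderiv hd), pdt_eq_fderiv (happ _),
    pdx_eq_fderiv (happ _), fderiv_clm_apply (hf' p) (by fun_prop),
    fderiv_clm_apply (hf' p) (by fun_prop)]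
  simpa using hsymm.eq (0, 1) (1, 0)

/-- The material derivative `∂_t - 2u ∂_x`. -/
noncomputable def materialDeriv (u f : ℝ × ℝ → ℝ) (p : ℝ × ℝ) : ℝ := pdt f p - 2 * u p * pdx f p

theorem materialDeriv_mul (u : ℝ × ℝ → ℝ) {f g : ℝ × ℝ → ℝ} (hf : Differentiable ℝ f)
    (hg : Differentiable ℝ g) (p : ℝ × ℝ) :
    materialDeriv u (fun q => f q * g q) p =
      materialDeriv u f p * g p + f p * materialDeriv u g p := by
  have ht : pdt (fun q => f q * g q) p = _ := ((hasDerivAt_pdt hf p).mul (hasDerivAt_pdt hg p)).deriv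
  have hx : pdx (fun q => f q * g q) p = _ := ((hasDerivAt_pdx hf p).mul (hasDerivAt_pdx hg p)).deriv
  rw [materialDeriv, ht, hx, materialDeriv, materialDeriv]
  ring

theorem materialDeriv_sub_const_mul (u : ℝ × ℝ → ℝ) {f g : ℝ × ℝ → ℝ} (hf : Differentiable ℝ f)
    (hg : Differentiable ℝ g) (c : ℝ) (p : ℝ × ℝ) :
    materialDeriv u (fun q => f q - c * g q) p = materialDeriv u f p - c * materialDeriv u g p := by
  have ht : pdt (fun q => f q - c * g q) p = _ :=
    ((hasDerivAt_pdt hf p).sub ((hasDerivAt_pdt hg p).const_mul c)).deriv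
  have hx : pdx (fun q => f q - c * g q) p = _ :=
    ((hasDerivAt_pdx hf p).sub ((hasDerivAt_pdx hg p).const_mul c)).deriv
  rw [materialDeriv, ht, hx, materialDeriv, materialDeriv]
  ring

theorem materialDeriv_inv (u : ℝ × ℝ → ℝ) {f : ℝ × ℝ → ℝ} (hf : Differentiable ℝ f)
    (p : ℝ × ℝ) (hp : f p ≠ 0) :
    materialDeriv u (fun q => (f q)⁻¹) p = -materialDeriv u f p / f p ^ 2 := by
  have ht : pdt (fun q => (f q)⁻¹) p = _ := ((hasDerivAt_pdt hf p).inv hp).deriv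
  have hx : pdx (fun q => (f q)⁻¹) p = _ := ((hasDerivAt_pdx hf p).inv hp).deriv
  rw [materialDeriv, ht, hx, materialDeriv]
  ring

theorem materialDeriv_pdx {u f g : ℝ × ℝ → ℝ} (hu : Differentiable ℝ u)
    (hf : ContDiff ℝ (⊤ : ℕ∞) f) (hg : Differentiable ℝ g)
    (h : ∀ p, materialDeriv u f p = g p) (p : ℝ × ℝ) :
    materialDeriv u (pdx f) p = 2 * pdx u p * pdx f p + pdx g p := by
  have hft : pdt f = fun q => 2 * u q * pdx f q + g q := by
    funext q
    linarith [h q, materialDeriv.eq_def u f q]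
  have hx : pdx (fun q => 2 * u q * pdx f q + g q) p = _ :=
    ((((hasDerivAt_pdx hu p).const_mul 2).mul
      (hasDerivAt_pdx (contDiff_pdx hf).differentiable_of_smooth p)).add (hasDerivAt_pdx hg p)).deriv
  rw [materialDeriv, pdt_pdx_comm hf, hft, hx]
  ring

theorem materialDeriv_inv_mul_pdx {u v f : ℝ × ℝ → ℝ} (hu : Differentiable ℝ u)
    (hv : ContDiff ℝ (⊤ : ℕ∞) v) (hf : ContDiff ℝ (⊤ : ℕ∞) f) (hvx : ∀ p, pdx v p ≠ 0)
    (hDv : ∀ p, materialDeriv u v p = 0) {g : ℝ × ℝ → ℝ} (hg : Differentiable ℝ g)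
    (hDf : ∀ p, materialDeriv u f p = g p) (p : ℝ × ℝ) :
    materialDeriv u (fun q => (pdx v q)⁻¹ * pdx f q) p = (pdx v p)⁻¹ * pdx g p := by
  have hv' := (contDiff_pdx hv).differentiable_of_smooth
  have h0 : pdx (fun _ => 0) p = 0 := deriv_const _ _
  rw [materialDeriv_mul u (f := fun q => (pdx v q)⁻¹) (hv'.inv hvx) (contDiff_pdx hf).differentiable_of_smooth,
    materialDeriv_inv u hv' p (hvx p), materialDeriv_pdx hu hf hg hDf,
    materialDeriv_pdx hu hv (differentiable_const 0) hDv, h0]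
  have := hvx p
  field_simp
  ring

theorem materialDeriv_iterate {u v : ℝ × ℝ → ℝ} (hu : Differentiable ℝ u)
    (hv : ContDiff ℝ (⊤ : ℕ∞) v) (hvx : ∀ p, pdx v p ≠ 0)
    (hDv : ∀ p, materialDeriv u v p = 0) {γ : ℕ → ℝ × ℝ → ℝ}
    (hrec : ∀ k, 1 ≤ k → ∀ p, γ (k + 1) p = (pdx v p)⁻¹ * pdx (γ k) p)
    (h1 : ContDiff ℝ (⊤ : ℕ∞) (γ 1)) {c : ℝ} (hD1 : ∀ p, materialDeriv u (γ 1) p = c)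
    (k : ℕ) (hk : 2 ≤ k) (p : ℝ × ℝ) : materialDeriv u (γ k) p = 0 := by
  have hstep (k : ℕ) (hk : 1 ≤ k) (d : ℝ) (hs : ContDiff ℝ (⊤ : ℕ∞) (γ k))
      (hD : ∀ p, materialDeriv u (γ k) p = d) :
      ContDiff ℝ (⊤ : ℕ∞) (γ (k + 1)) ∧ ∀ p, materialDeriv u (γ (k + 1)) p = 0 := by
    rw [funext (hrec k hk)]
    refine ⟨((contDiff_pdx hv).inv hvx).mul (contDiff_pdx hs), fun p => ?_⟩
    have h0 : pdx (fun _ => d) p = 0 := deriv_const _ _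
    rw [materialDeriv_inv_mul_pdx hu hv hs hvx hDv (differentiable_const d) hD, h0, mul_zero]
  have key : ContDiff ℝ (⊤ : ℕ∞) (γ k) ∧ ∀ p, materialDeriv u (γ k) p = 0 := by
    induction k, hk using Nat.le_induction with
    | base => exact hstep 1 le_rfl c h1 hD1
    | succ k hk ih => exact hstep k (by omega) 0 ih.1 ih.2
  exact key.2 p

theorem riemannN2_evolution_of_alpha_beta (u v : ℝ × ℝ → ℝ)
    (hu : ContDiff ℝ (⊤ : ℕ∞) u) (hv : ContDiff ℝ (⊤ : ℕ∞) v)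
    (hequ : ∀ p : ℝ × ℝ, pdt u p = 2 * u p * pdx u p - 2 * v p)
    (heqv : ∀ p : ℝ × ℝ, pdt v p = 2 * u p * pdx v p)
    (hvx : ∀ p : ℝ × ℝ, pdx v p ≠ 0)
    (α β : ℕ → ℝ × ℝ → ℝ)
    (hα1 : ∀ p : ℝ × ℝ, α 1 p = (pdx u p) ^ 2 * ((pdx v p) ^ 2)⁻¹ - 2 * (pdx v p)⁻¹)
    (hβ1 : ∀ p : ℝ × ℝ, β 1 p = pdx u p * (pdx v p)⁻¹)
    (hαrec : ∀ k, 1 ≤ k → ∀ p : ℝ × ℝ, α (k + 1) p = (pdx v p)⁻¹ * pdx (α k) p)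
    (hβrec : ∀ k, 1 ≤ k → ∀ p : ℝ × ℝ, β (k + 1) p = (pdx v p)⁻¹ * pdx (β k) p) :
    (∀ k, 1 ≤ k → ∀ p : ℝ × ℝ, pdt (α k) p = 2 * u p * pdx (α k) p) ∧
    (∀ p : ℝ × ℝ, pdt (β 1) p = 2 * u p * pdx (β 1) p - 2) ∧
    (∀ k, 2 ≤ k → ∀ p : ℝ × ℝ, pdt (β k) p = 2 * u p * pdx (β k) p) := by
  have hud := hu.differentiable_of_smooth
  have hvd := hv.differentiable_of_smooth
  have hDu (p : ℝ × ℝ) : materialDeriv u u p = -2 * v p := by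
    rw [materialDeriv, hequ]
    ring
  have hDv (p : ℝ × ℝ) : materialDeriv u v p = 0 := by
    rw [materialDeriv, heqv, sub_self]
  have hw : ContDiff ℝ (⊤ : ℕ∞) fun q => (pdx v q)⁻¹ := (contDiff_pdx hv).inv hvx
  have hDw (p : ℝ × ℝ) :
      materialDeriv u (fun q => (pdx v q)⁻¹) p = -2 * pdx u p * (pdx v p)⁻¹ := by
    have h0 : pdx (fun _ => 0) p = 0 := deriv_const _ _
    rw [materialDeriv_inv u (contDiff_pdx hv).differentiable_of_smooth p (hvx p),
      materialDeriv_pdx hud hv (differentiable_const 0) hDv, h0]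
    have := hvx p
    field_simp
    ring
  have hβ : β 1 = fun q => (pdx v q)⁻¹ * pdx u q := by
    funext q
    rw [hβ1, mul_comm]
  have hβs : ContDiff ℝ (⊤ : ℕ∞) (β 1) := hβ ▸ hw.mul (contDiff_pdx hu)
  have hDβ (p : ℝ × ℝ) : materialDeriv u (β 1) p = -2 := by
    have h2 : pdx (fun q => -2 * v q) p = -2 * pdx v p :=
      ((hasDerivAt_pdx hvd p).const_mul (-2)).deriv
    rw [hβ, materialDeriv_inv_mul_pdx hud hv hu hvx hDv (hvd.const_mul (-2)) hDu, h2]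
    have := hvx p
    field_simp
  have hα : α 1 = fun q => β 1 q * β 1 q - 2 * (pdx v q)⁻¹ := by
    funext q
    rw [hα1, hβ1]
    ring
  have hαs : ContDiff ℝ (⊤ : ℕ∞) (α 1) :=
    hα ▸ (hβs.mul hβs).sub (contDiff_const.mul hw)
  have hβd := hβs.differentiable_of_smooth
  have hDα (p : ℝ × ℝ) : materialDeriv u (α 1) p = 0 := by
    rw [hα, materialDeriv_sub_const_mul u (f := fun q => β 1 q * β 1 q) (hβd.mul hβd)
      hw.differentiable_of_smooth,
      materialDeriv_mul u hβd hβd, hDβ, hDw, hβ1]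
    ring
  refine ⟨fun k hk p => sub_eq_zero.mp ?_, fun p => ?_, fun k hk p => sub_eq_zero.mp ?_⟩
  · rcases hk.eq_or_lt with rfl | hk
    · exact hDα p
    · exact materialDeriv_iterate hud hv hvx hDv hαrec hαs hDα k hk p
  · linarith [hDβ p, materialDeriv.eq_def u (β 1) p]
  · exact materialDeriv_iterate hud hv hvx hDv hβrec hβs hDβ k hk p
end

section
/- Let ū, v̄ : ℝ → ℝ be differentiable functions of τ satisfying the ODE system ū' = 2ū² − 2v̄, v̄' = 2ū·v̄, and suppose v̄ is nowhere zero. Then the function p = (ū² − 2v̄)/v̄² is constant (p' = 0 everywhere) and the function q = ū/v̄ satisfies q' = −2 everywhere. -/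
theorem riemannN2_ode_linearization (ub vb : ℝ → ℝ)
    (hub : Differentiable ℝ ub) (hvb : Differentiable ℝ vb)
    (hequ : ∀ τ : ℝ, deriv ub τ = 2 * (ub τ) ^ 2 - 2 * vb τ)
    (heqv : ∀ τ : ℝ, deriv vb τ = 2 * ub τ * vb τ)
    (hv : ∀ τ : ℝ, vb τ ≠ 0) :
    (∀ τ : ℝ, deriv (fun s => ((ub s) ^ 2 - 2 * vb s) / (vb s) ^ 2) τ = 0) ∧
    (∀ τ : ℝ, deriv (fun s => ub s / vb s) τ = -2) := by
  have hu' (τ : ℝ) : HasDerivAt ub (2 * (ub τ) ^ 2 - 2 * vb τ) τ :=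
    hequ τ ▸ (hub τ).hasDerivAt
  have hv' (τ : ℝ) : HasDerivAt vb (2 * ub τ * vb τ) τ :=
    heqv τ ▸ (hvb τ).hasDerivAt
  refine ⟨fun τ => ?_, fun τ => ?_⟩
  · have h := (((hu' τ).fun_pow 2).fun_sub ((hv' τ).const_mul 2)).fun_div ((hv' τ).fun_pow 2)
      (pow_ne_zero 2 (hv τ))
    rw [h.deriv, div_eq_zero_iff]
    left
    push_cast
    ring
  · have h := (hu' τ).fun_div (hv' τ) (hv τ)
    rw [h.deriv, div_eq_iff (pow_ne_zero 2 (hv τ))]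
    ring
end
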